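/- Let E be a real Hilbert space, f: E → ℝ a smooth function, ψ: ℝ × E → E a negative gradient flow of f, and N ⊆ E a compact set. If x ∈ E has its entire orbit {ψ(t,x) : t ∈ ℝ} contained in N, then every point of the ω-limit set ω(x) and every point of the α-limit set α(x) is a critical point of f, i.e. ω(x) ∪ α(x) ⊆ crit(f) ∩ N. -/

import Mathlib

open Set Filter

theorem ContDiff.continuous_gradient
    {E : Type*} [NormedAddCommGroup E] [InnerProductSpace ℝ E] [CompleteSpace E]
    {f : E → ℝ} (hf : ContDiff ℝ (⊤ : ℕ∞) f) : Continuous (gradient f) :=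
  (InnerProductSpace.toDual ℝ E).symm.continuous.comp (hf.continuous_fderiv (by simp))

/-- Along a curve solving the negative gradient equation, `f` has derivative `-‖∇f‖ ^ 2`. -/
theorem hasDerivAt_comp_of_neg_gradient
    {E : Type*} [NormedAddCommGroup E] [InnerProductSpace ℝ E] [CompleteSpace E]
    {f : E → ℝ} (hf : Differentiable ℝ f) {γ : ℝ → E}
    (hγ : ∀ t, HasDerivAt γ (-(gradient f (γ t))) t) (t : ℝ) :
    HasDerivAt (fun s => f (γ s)) (-‖gradient f (γ t)‖ ^ 2) t := by
  have h := (hf (γ t)).hasGradientAt.hasFDerivAt.comp_hasDerivAt t (hγ t)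
  rwa [InnerProductSpace.toDual_apply_apply, inner_neg_right, real_inner_self_eq_norm_sq] at h

/-- If the speed of a negative gradient curve is bounded and the energy converges along `l`
and `l` is translation invariant, then every limit point along `l` is critical. -/
theorem gradient_eq_zero_of_tendsto_energy
    {E : Type*} [NormedAddCommGroup E] [InnerProductSpace ℝ E] [CompleteSpace E]
    {f : E → ℝ} (hf : ContDiff ℝ (⊤ : ℕ∞) f) {γ : ℝ → E}
    (hγ : ∀ t, HasDerivAt γ (-(gradient f (γ t))) t)
    {M : ℝ} (hM : ∀ t, ‖gradient f (γ t)‖ ≤ M)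
    {l : Filter ℝ} {L : ℝ} (hL : Tendsto (fun t => f (γ t)) l (nhds L))
    (hl : ∀ h : ℝ, Tendsto (fun t => t + h) l l)
    {tn : ℕ → ℝ} (htn : Tendsto tn atTop l) {y : E}
    (hy : Tendsto (fun n => γ (tn n)) atTop (nhds y)) : gradient f y = 0 := by
  by_contra hne
  have hM0 : 0 ≤ M := (norm_nonneg _).trans (hM 0)
  have hpos : 0 < ‖gradient f y‖ := norm_pos_iff.mpr hne
  set c := ‖gradient f y‖ / 2 with hc
  have hc0 : 0 < c := by positivity
  have hev : ∀ᶠ z in nhds y, c < ‖gradient f z‖ :=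
    hf.continuous_gradient.norm.continuousAt.eventually (lt_mem_nhds (by rw [hc]; linarith))
  obtain ⟨δ, hδ, hball⟩ := Metric.eventually_nhds_iff.mp hev
  set h := δ / (2 * (M + 1)) with hh
  have hh0 : 0 < h := by positivity
  have hMh : M * h < δ / 2 := by
    have : (M + 1) * h = δ / 2 := by rw [hh]; field_simp
    linarith
  have hdiff : Tendsto (fun n => f (γ (tn n)) - f (γ (tn n + h))) atTop (nhds 0) := by
    simpa using (hL.comp htn).sub (hL.comp ((hl h).comp htn))
  have hsmall := hdiff.eventually (gt_mem_nhds (show (0 : ℝ) < c ^ 2 * h by positivity))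
  have hnear := hy.eventually (Metric.ball_mem_nhds y (half_pos hδ))
  obtain ⟨n, hn, hny⟩ := (hsmall.and hnear).exists
  have hderiv := hasDerivAt_comp_of_neg_gradient (hf.differentiable (by simp)) hγ
  obtain ⟨s, hs, hslope⟩ := exists_hasDerivAt_eq_slope (fun s => f (γ s)) _
    (show tn n < tn n + h by linarith)
    (fun s _ => (hderiv s).continuousAt.continuousWithinAt) (fun s _ => hderiv s)
  have hlip : ‖γ s - γ (tn n)‖ ≤ M * ‖s - tn n‖ :=
    convex_univ.norm_image_sub_le_of_norm_hasDerivWithin_le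
      (fun t _ => (hγ t).hasDerivWithinAt) (fun t _ => by simpa using hM t)
      (mem_univ _) (mem_univ _)
  have hst : ‖s - tn n‖ ≤ h := by
    rw [Real.norm_eq_abs, abs_of_pos (by linarith [hs.1])]
    linarith [hs.2]
  have hsy : dist (γ s) y < δ := by
    have h1 := dist_triangle (γ s) (γ (tn n)) y
    have h2 : dist (γ (tn n)) y < δ / 2 := hny
    rw [dist_eq_norm (γ s) (γ (tn n))] at h1
    have h3 := mul_le_mul_of_nonneg_left hst hM0
    linarith
  have hcs : c ^ 2 ≤ ‖gradient f (γ s)‖ ^ 2 := pow_le_pow_left₀ hc0.le (hball hsy).le 2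
  rw [add_sub_cancel_left, eq_div_iff hh0.ne'] at hslope
  have := mul_le_mul_of_nonneg_right hcs hh0.le
  linarith

/-- For a negative gradient flow `ψ` of a smooth function `f` on a real
Hilbert space, if the entire orbit of `x` stays in the compact set `N`, then every
α- or ω-limit point of `x` is a critical point of `f` lying in `N`. -/
theorem statement5
    {E : Type*} [NormedAddCommGroup E] [InnerProductSpace ℝ E] [CompleteSpace E]
    (f : E → ℝ) (hfsmooth : ContDiff ℝ (⊤ : ℕ∞) f)
    (ψ : ℝ × E → E)
    (hψ0 : ∀ x, ψ (0, x) = x)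
    (hψgrp : ∀ t s x, ψ (t, ψ (s, x)) = ψ (t + s, x))
    (hψode : ∀ t x, HasDerivAt (fun s => ψ (s, x)) (-(gradient f (ψ (t, x)))) t)
    (N : Set E) (hNcpt : IsCompact N)
    (x : E) (horbit : ∀ t : ℝ, ψ (t, x) ∈ N)
    (y : E)
    (hy : (∃ tn : ℕ → ℝ, Tendsto tn atTop atTop ∧
            Tendsto (fun n => ψ (tn n, x)) atTop (nhds y)) ∨
          (∃ tn : ℕ → ℝ, Tendsto tn atTop atBot ∧
            Tendsto (fun n => ψ (tn n, x)) atTop (nhds y))) :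
    gradient f y = 0 ∧ y ∈ N := by
  have hγ : ∀ t, HasDerivAt (fun s => ψ (s, x)) (-(gradient f (ψ (t, x)))) t :=
    fun t => hψode t x
  have hderiv := hasDerivAt_comp_of_neg_gradient (hfsmooth.differentiable (by simp)) hγ
  have hanti : Antitone (fun t => f (ψ (t, x))) :=
    antitone_of_deriv_nonpos (fun t => (hderiv t).differentiableAt)
      (fun t => by rw [(hderiv t).deriv]; exact neg_nonpos.mpr (sq_nonneg _))
  have hsub : range (fun t => f (ψ (t, x))) ⊆ f '' N :=
    range_subset_iff.mpr fun t => mem_image_of_mem f (horbit t)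
  have hcpt : IsCompact (f '' N) := hNcpt.image hfsmooth.continuous
  obtain ⟨M, hM⟩ := hNcpt.exists_bound_of_continuousOn
    hfsmooth.continuous_gradient.continuousOn
  have hMt := fun t => hM _ (horbit t)
  rcases hy with ⟨tn, htn, hlim⟩ | ⟨tn, htn, hlim⟩
  · exact ⟨gradient_eq_zero_of_tendsto_energy hfsmooth hγ hMt
      (tendsto_atTop_ciInf hanti (hcpt.bddBelow.mono hsub))
      (fun h => tendsto_atTop_add_const_right _ h tendsto_id) htn hlim,
      hNcpt.isClosed.mem_of_tendsto hlim (Eventually.of_forall fun n => horbit _)⟩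
  · exact ⟨gradient_eq_zero_of_tendsto_energy hfsmooth hγ hMt
      (tendsto_atBot_ciSup hanti (hcpt.bddAbove.mono hsub))
      (fun h => tendsto_atBot_add_const_right _ h tendsto_id) htn hlim,
      hNcpt.isClosed.mem_of_tendsto hlim (Eventually.of_forall fun n => horbit _)⟩
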